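/- Let n ≥ 1 be an integer, α > −1 a real number, a : [0,1) → ℂ a bounded measurable function, and ω ∈ ℂ such that a(r) → ω as r → 1⁻. Then lim_{ξ→+∞} γ(a)_ξ = ω I_n entrywise; that is, for all j, k ∈ {0,…,n−1}, γ(a)_{ξ,j,k} → ω·δ_{j,k} as the integer ξ → +∞. -/

import Mathlib

open MeasureTheory Filter
open scoped ENNReal

noncomputable section

/-- Generalized binomial coefficient `x(x-1)⋯(x-j+1)/j!`. -/
def gbinom (x : ℝ) (j : ℕ) : ℝ :=
  (∏ i ∈ Finset.range j, (x - i)) / (Nat.factorial j)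

/-- Shifted Jacobi polynomial `Q_m^{(α,β)}` on `[0,1]`:
`Q_m^{(α,β)}(t) = Σ_{k=0}^m binom(α+β+m+k,k)·binom(β+m,m-k)·(-1)^{m-k}·t^k`. -/
def jacQ (α β : ℝ) (m : ℕ) (t : ℝ) : ℝ :=
  ∑ k ∈ Finset.range (m + 1),
    gbinom (α + β + m + k) k * gbinom (β + m) (m - k) * (-1 : ℝ) ^ (m - k) * t ^ k

/-- Normalizing coefficient
`κ(α,β,m) = sqrt((2m+α+β+1)·Γ(m+α+β+1)·m!/(Γ(m+α+1)·Γ(m+β+1)))`. -/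
def jacCoef (α β : ℝ) (m : ℕ) : ℝ :=
  Real.sqrt ((2 * m + α + β + 1) * Real.Gamma (m + α + β + 1) * (Nat.factorial m) /
    (Real.Gamma (m + α + 1) * Real.Gamma (m + β + 1)))

/-- Jacobi function `J_m^{(α,β)}(t) = κ(α,β,m)·(1-t)^{α/2}·t^{β/2}·Q_m^{(α,β)}(t)`. -/
def jacJ (α β : ℝ) (m : ℕ) (t : ℝ) : ℝ :=
  jacCoef α β m * (1 - t) ^ (α / 2) * t ^ (β / 2) * jacQ α β m t

/-- `dd n ξ = min(n+ξ, n)` (for `ξ ≥ 1-n`), written as a total function into `ℕ`. -/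
def dd (n : ℕ) (ξ : ℤ) : ℕ := n - (-ξ).toNat

lemma dd_le (n : ℕ) (ξ : ℤ) : dd n ξ ≤ n := Nat.sub_le _ _

/-- The set `Ω_n = {ξ ∈ ℤ : ξ ≥ -n+1}` as a subtype. -/
abbrev Om (n : ℕ) : Type := {ξ : ℤ // 1 - (n : ℤ) ≤ ξ}

/-- The entry `γ(a)_{ξ,j,k} = κ(α,|ξ|,j)·κ(α,|ξ|,k)·
∫₀¹ a(√t)·Q_j^{(α,|ξ|)}(t)·Q_k^{(α,|ξ|)}(t)·(1-t)^α·t^{|ξ|} dt`. -/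
def gammaEnt (α : ℝ) (a : ℝ → ℂ) (ξ : ℤ) (j k : ℕ) : ℂ :=
  ((jacCoef α ξ.natAbs j * jacCoef α ξ.natAbs k : ℝ) : ℂ) *
    ∫ t in (0:ℝ)..1, a (Real.sqrt t) *
      ((jacQ α ξ.natAbs j t * jacQ α ξ.natAbs k t * (1 - t) ^ α * t ^ (ξ.natAbs) : ℝ) : ℂ)

/-- The matrix `γ(a)_ξ ∈ M_{d_ξ}(ℂ)`. -/
def gammaMat (n : ℕ) (α : ℝ) (a : ℝ → ℂ) (ξ : ℤ) :
    Matrix (Fin (dd n ξ)) (Fin (dd n ξ)) ℂ :=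
  Matrix.of fun j k => gammaEnt α a ξ (j : ℕ) (k : ℕ)

/-- Bounded measurable functions on `[0,1)` having a finite limit at `1⁻`. -/
def LinfLim (a : ℝ → ℂ) : Prop :=
  Measurable a ∧ (∃ C : ℝ, ∀ r ∈ Set.Ico (0:ℝ) 1, ‖a r‖ ≤ C) ∧
    ∃ ω : ℂ, Tendsto a (nhdsWithin 1 (Set.Ico (0:ℝ) 1)) (nhds ω)

/-- The generating symbol `g_p(t) = Q_p^{(α,0)}(t²)`, as a complex-valued function. -/
def gSym (α : ℝ) (p : ℕ) (t : ℝ) : ℂ := ((jacQ α 0 p (t ^ 2) : ℝ) : ℂ)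

/-- `⟨A w, w⟩ = Σ_{j,k} conj(w_j)·A_{j,k}·w_k`. -/
def innerForm {d : ℕ} (A : Matrix (Fin d) (Fin d) ℂ) (w : Fin d → ℂ) : ℂ :=
  ∑ j : Fin d, ∑ k : Fin d, (starRingEnd ℂ) (w j) * A j k * w k

open Polynomial in
/-- Alternating binomial sums of order `m` annihilate polynomials of degree less than `m`. -/
lemma sum_alternating_choose_mul_eval_eq_zero {m : ℕ} {P : ℝ[X]} (hP : P.natDegree < m) :
    ∑ k ∈ Finset.range (m + 1), (-1 : ℝ) ^ (m - k) * m.choose k * P.eval (k : ℝ) = 0 := by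
  have h := congrFun (P.fwdDiff_iter_eq_zero_of_degree_lt hP) 0
  rw [fwdDiff_iter_eq_sum_shift] at h
  simpa using h

lemma fwdDiff_iter_inv (m : ℕ) {c : ℝ} (hc : 0 < c) :
    (fwdDiff 1)^[m] (fun x : ℝ => x⁻¹) c =
      (-1) ^ m * m.factorial * Real.Gamma c / Real.Gamma (c + m + 1) := by
  induction m generalizing c with
  | zero =>
    have := (Real.Gamma_pos_of_pos hc).ne'
    simp only [Function.iterate_zero, id, Nat.cast_zero, add_zero, Real.Gamma_add_one hc.ne']
    field_simp
    simp
  | succ m ih =>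
    rw [Function.iterate_succ_apply', fwdDiff, ih hc, ih (by linarith : 0 < c + 1)]
    have hcm : 0 < c + m + 1 := by positivity
    have h1 : c + 1 + m + 1 = c + m + 1 + 1 := by ring
    have h2 : c + (m + 1 : ℕ) + 1 = c + m + 1 + 1 := by push_cast; ring
    have := (Real.Gamma_pos_of_pos hcm).ne'
    rw [h1, h2, Real.Gamma_add_one hc.ne', Real.Gamma_add_one hcm.ne', Nat.factorial_succ]
    push_cast
    field_simp
    ring

lemma sum_alternating_choose_mul_inv (m : ℕ) {c : ℝ} (hc : 0 < c) :
    ∑ k ∈ Finset.range (m + 1), (-1 : ℝ) ^ (m - k) * m.choose k * (k + c)⁻¹ =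
      (-1) ^ m * m.factorial * Real.Gamma c / Real.Gamma (c + m + 1) := by
  rw [← fwdDiff_iter_inv m hc, fwdDiff_iter_eq_sum_shift]
  simp [add_comm c]

open Polynomial in
/-- The alternating binomial sum of `P(k) / (k + c)` only depends on the residue `P(-c)`. -/
lemma sum_alternating_choose_mul_eval_mul_inv {m : ℕ} {P : ℝ[X]} (hP : P.natDegree ≤ m) {c : ℝ}
    (hc : 0 < c) :
    ∑ k ∈ Finset.range (m + 1), (-1 : ℝ) ^ (m - k) * m.choose k * (P.eval (k : ℝ) * (k + c)⁻¹) =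
      P.eval (-c) * ((-1) ^ m * m.factorial * Real.Gamma c / Real.Gamma (c + m + 1)) := by
  set q := P /ₘ (X - C (-c)) with hq
  have hev (x : ℝ) : P.eval x = P.eval (-c) + (x + c) * q.eval x := by
    conv_lhs => rw [← modByMonic_add_div P (X - C (-c)), modByMonic_X_sub_C_eq_C_eval]
    simp [hq]
  have hsum : ∑ k ∈ Finset.range (m + 1), (-1 : ℝ) ^ (m - k) * m.choose k * q.eval (k : ℝ) = 0 := by
    rcases Nat.eq_zero_or_pos m with rfl | hm
    · have : q = 0 := by
        rw [hq, divByMonic_eq_zero_iff (monic_X_sub_C _), degree_X_sub_C]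
        exact (natDegree_eq_zero_iff_degree_le_zero.1 (by lia)).trans_lt (by norm_num)
      simp [this]
    · apply sum_alternating_choose_mul_eval_eq_zero
      rw [hq, natDegree_divByMonic _ (monic_X_sub_C _), natDegree_X_sub_C]
      lia
  rw [← sum_alternating_choose_mul_inv m hc, Finset.mul_sum, ← sub_eq_zero,
    ← Finset.sum_sub_distrib, ← hsum]
  refine Finset.sum_congr rfl fun k _ => ?_
  have : (k : ℝ) + c ≠ 0 := by positivity
  rw [hev k]
  field_simp
  ring

lemma Gamma_add_natCast_eq_prod {x : ℝ} (hx : 0 < x) (n : ℕ) :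
    Real.Gamma (x + n) = (∏ i ∈ Finset.range n, (x + i)) * Real.Gamma x := by
  induction n with
  | zero => simp
  | succ n ih =>
    have : 0 < x + n := by positivity
    rw [Nat.cast_succ, ← add_assoc, Real.Gamma_add_one this.ne', ih, Finset.prod_range_succ]
    ring

lemma prod_sub_mul_Gamma (j : ℕ) {x : ℝ} (hx : 0 < x - j + 1) :
    (∏ i ∈ Finset.range j, (x - i)) * Real.Gamma (x - j + 1) = Real.Gamma (x + 1) := by
  induction j with
  | zero => simp
  | succ j ih =>
    push_cast at hx ⊢
    have h : 0 < x - j := by linarith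
    rw [Finset.prod_range_succ, ← ih (by linarith), Real.Gamma_add_one h.ne']
    ring_nf

lemma gbinom_eq_Gamma_div (j : ℕ) {x : ℝ} (hx : 0 < x - j + 1) :
    gbinom x j = Real.Gamma (x + 1) / (j.factorial * Real.Gamma (x - j + 1)) := by
  have := (Real.Gamma_pos_of_pos hx).ne'
  rw [gbinom, ← prod_sub_mul_Gamma j hx]
  field_simp

lemma abs_gbinom_le (x : ℝ) (j : ℕ) : |gbinom x j| ≤ (|x| + j) ^ j := by
  rw [gbinom, abs_div, Finset.abs_prod]
  refine (div_le_self (Finset.prod_nonneg fun _ _ => abs_nonneg _) ?_).trans ?_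
  · rw [Nat.abs_cast]
    exact_mod_cast Nat.one_le_of_lt j.factorial_pos
  · refine (Finset.prod_le_prod (g := fun _ => |x| + j) (fun _ _ => abs_nonneg _)
      fun i hi => ?_).trans (by simp)
    have : (i : ℝ) ≤ j := by exact_mod_cast (Finset.mem_range.1 hi).le
    exact (abs_sub _ _).trans (by simpa using this)

lemma intervalIntegrable_one_sub_rpow {α : ℝ} (hα : -1 < α) :
    IntervalIntegrable (fun t : ℝ => (1 - t) ^ α) volume 0 1 := by
  have h := (intervalIntegral.intervalIntegrable_rpow' hα (a := 0) (b := 1)).comp_sub_left 1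
  simpa using h.symm

lemma intervalIntegrable_mul_one_sub_rpow {α : ℝ} (hα : -1 < α) {f : ℝ → ℝ} (hf : Continuous f) :
    IntervalIntegrable (fun t : ℝ => f t * (1 - t) ^ α) volume 0 1 :=
  (intervalIntegrable_one_sub_rpow hα).continuousOn_mul hf.continuousOn

lemma integral_pow_mul_one_sub_rpow {α : ℝ} (hα : -1 < α) (q : ℕ) :
    ∫ t in (0 : ℝ)..1, t ^ q * (1 - t) ^ α =
      Real.Gamma (q + 1) * Real.Gamma (α + 1) / Real.Gamma (q + α + 2) := by
  have h := ProbabilityTheory.beta_eq_betaIntegralReal (q + 1) (α + 1) (by positivity) (by linarith)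
  rw [ProbabilityTheory.beta, show (q : ℝ) + 1 + (α + 1) = q + α + 2 by ring] at h
  rw [h, Complex.betaIntegral, ← Complex.ofReal_re (∫ t in (0 : ℝ)..1, t ^ q * (1 - t) ^ α),
    ← intervalIntegral.integral_ofReal]
  congr 1
  refine intervalIntegral.integral_congr fun t ht => ?_
  rw [Set.uIcc_of_le zero_le_one] at ht
  have h1 : (0 : ℝ) ≤ 1 - t := by linarith [ht.2]
  simp [Complex.ofReal_cpow h1]

lemma continuous_jacQ (α β : ℝ) (m : ℕ) : Continuous (jacQ α β m) := by
  unfold jacQ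
  fun_prop

lemma integral_jacQ_mul_pow {α : ℝ} (hα : -1 < α) (N m p : ℕ) :
    ∫ t in (0 : ℝ)..1, jacQ α N m t * t ^ (p + N) * (1 - t) ^ α =
      Real.Gamma (N + m + 1) * Real.Gamma (α + 1) / (m.factorial * Real.Gamma (α + N + m + 1)) *
      ∑ k ∈ Finset.range (m + 1), (-1 : ℝ) ^ (m - k) * m.choose k *
        (Real.Gamma (N + k + 1 + p) / Real.Gamma (N + k + 1) *
          (Real.Gamma (α + N + m + k + 1) / Real.Gamma (N + k + p + α + 2))) := by
  have hexp (t : ℝ) : jacQ α N m t * t ^ (p + N) * (1 - t) ^ α =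
      ∑ k ∈ Finset.range (m + 1), gbinom (α + N + m + k) k * gbinom (N + m) (m - k) *
        (-1 : ℝ) ^ (m - k) * (t ^ (N + k + p) * (1 - t) ^ α) := by
    rw [jacQ, Finset.sum_mul, Finset.sum_mul]
    exact Finset.sum_congr rfl fun k _ => by ring
  simp_rw [hexp]
  rw [intervalIntegral.integral_finsetSum fun k _ =>
    (intervalIntegrable_mul_one_sub_rpow hα (continuous_pow _)).const_mul _, Finset.mul_sum]
  refine Finset.sum_congr rfl fun k hk => ?_
  have hkm : k ≤ m := Nat.lt_succ_iff.1 (Finset.mem_range.1 hk)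
  have hN : (0 : ℝ) ≤ N := N.cast_nonneg
  have hm : (0 : ℝ) ≤ m := m.cast_nonneg
  have hk0 : (0 : ℝ) ≤ k := k.cast_nonneg
  have hc : (m.choose k : ℝ) = m.factorial / (k.factorial * (m - k).factorial) :=
    Nat.cast_choose ℝ hkm
  have e1 : α + N + m + k - k + 1 = α + N + m + 1 := by ring
  have e2 : (N : ℝ) + m - (m - k : ℕ) + 1 = N + k + 1 := by rw [Nat.cast_sub hkm]; ring
  rw [intervalIntegral.integral_const_mul, integral_pow_mul_one_sub_rpow hα,
    gbinom_eq_Gamma_div k (by rw [e1]; linarith), gbinom_eq_Gamma_div (m - k) (by rw [e2]; linarith),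
    e1, e2, hc]
  have h1 := (Real.Gamma_pos_of_pos (by linarith : 0 < α + N + m + 1)).ne'
  have h2 := (Real.Gamma_pos_of_pos (by linarith : 0 < (N : ℝ) + k + 1)).ne'
  push_cast
  rw [show (N : ℝ) + k + p + 1 = N + k + 1 + p by ring]
  field_simp

open Polynomial in
/-- The rising factorial `x ↦ (x + y)(x + y + 1)⋯(x + y + n - 1)`. -/
def risingPoly (y : ℝ) (n : ℕ) : ℝ[X] := ∏ i ∈ Finset.range n, (X + C (y + i))

lemma natDegree_risingPoly (y : ℝ) (n : ℕ) : (risingPoly y n).natDegree = n := by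
  rw [risingPoly, Polynomial.natDegree_prod_of_monic _ _ fun i _ => Polynomial.monic_X_add_C _]
  simp only [Polynomial.natDegree_X_add_C, Finset.sum_const, Finset.card_range, smul_eq_mul, mul_one]

lemma eval_risingPoly (y x : ℝ) (n : ℕ) :
    (risingPoly y n).eval x = ∏ i ∈ Finset.range n, (x + (y + i)) := by
  simp [risingPoly, Polynomial.eval_prod]

lemma Gamma_add_natCast_div_Gamma {y x : ℝ} (h : 0 < x + y) (n : ℕ) :
    Real.Gamma (x + y + n) / Real.Gamma (x + y) = (risingPoly y n).eval x := by
  have := (Real.Gamma_pos_of_pos h).ne'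
  rw [Gamma_add_natCast_eq_prod h, eval_risingPoly]
  field_simp
  simp only [add_assoc]

/-- `Q_m` is orthogonal to monomials of lower degree. -/
lemma integral_jacQ_mul_pow_of_lt {α : ℝ} (hα : -1 < α) (N : ℕ) {m p : ℕ} (hp : p < m) :
    ∫ t in (0 : ℝ)..1, jacQ α N m t * t ^ (p + N) * (1 - t) ^ α = 0 := by
  obtain ⟨d, rfl⟩ := Nat.exists_eq_add_of_lt hp
  rw [integral_jacQ_mul_pow hα, mul_eq_zero]
  right
  have hdeg : (risingPoly (N + 1) p * risingPoly (N + p + α + 2) d).natDegree < p + d + 1 := by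
    refine Polynomial.natDegree_mul_le.trans_lt ?_
    simp [natDegree_risingPoly]
  rw [← sum_alternating_choose_mul_eval_eq_zero hdeg]
  refine Finset.sum_congr rfl fun k _ => ?_
  have hN : (0 : ℝ) ≤ N := N.cast_nonneg
  have hp0 : (0 : ℝ) ≤ p := p.cast_nonneg
  have hk0 : (0 : ℝ) ≤ k := k.cast_nonneg
  rw [Polynomial.eval_mul, ← Gamma_add_natCast_div_Gamma (by linarith),
    ← Gamma_add_natCast_div_Gamma (by linarith)]
  push_cast
  ring_nf

lemma integral_jacQ_mul_pow_self {α : ℝ} (hα : -1 < α) (N m : ℕ) :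
    ∫ t in (0 : ℝ)..1, jacQ α N m t * t ^ (m + N) * (1 - t) ^ α =
      Real.Gamma (N + m + 1) * Real.Gamma (α + m + 1) / Real.Gamma (α + N + 2 * m + 2) := by
  have hN : (0 : ℝ) ≤ N := N.cast_nonneg
  have hm : (0 : ℝ) ≤ m := m.cast_nonneg
  have hc : 0 < α + N + m + 1 := by linarith
  have hterm : ∀ k ∈ Finset.range (m + 1), (-1 : ℝ) ^ (m - k) * m.choose k *
        (Real.Gamma (N + k + 1 + m) / Real.Gamma (N + k + 1) *
          (Real.Gamma (α + N + m + k + 1) / Real.Gamma (N + k + m + α + 2))) =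
      (-1 : ℝ) ^ (m - k) * m.choose k *
        ((risingPoly (N + 1) m).eval (k : ℝ) * (k + (α + N + m + 1))⁻¹) := fun k _ => by
    have hk0 : (0 : ℝ) ≤ k := k.cast_nonneg
    have h : 0 < k + (α + N + m + 1) := by linarith
    have hG := (Real.Gamma_pos_of_pos h).ne'
    rw [← Gamma_add_natCast_div_Gamma (by linarith),
      show (N : ℝ) + k + m + α + 2 = k + (α + N + m + 1) + 1 by ring, Real.Gamma_add_one h.ne',
      show α + N + m + k + 1 = k + (α + N + m + 1) by ring,
      show (N : ℝ) + k + 1 = k + (N + 1) by ring]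
    field_simp
  have hres : (risingPoly (N + 1) m).eval (-(α + N + m + 1)) * Real.Gamma (α + 1) =
      (-1) ^ m * Real.Gamma (α + m + 1) := by
    have h := prod_sub_mul_Gamma m (x := α + m) (by linarith)
    rw [show α + m - m + 1 = α + 1 by ring] at h
    rw [← h, eval_risingPoly, ← mul_assoc]
    congr 1
    rw [← Finset.card_range m, ← Finset.prod_const, Finset.card_range, ← Finset.prod_mul_distrib]
    exact Finset.prod_congr rfl fun i _ => by ring
  rw [integral_jacQ_mul_pow hα, Finset.sum_congr rfl hterm,
    sum_alternating_choose_mul_eval_mul_inv (natDegree_risingPoly _ _).le hc]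
  have h1 := (Real.Gamma_pos_of_pos hc).ne'
  have hsq : ((-1 : ℝ) ^ m) * (-1) ^ m = 1 := by rw [← mul_pow]; simp
  rw [show α + N + m + 1 + m + 1 = α + N + 2 * m + 2 by ring]
  have h2 := (Real.Gamma_pos_of_pos (by linarith : 0 < α + N + 2 * m + 2)).ne'
  generalize Real.Gamma (α + N + 2 * m + 2) = G at h2 ⊢
  field_simp
  linear_combination (-1) ^ m * hres + Real.Gamma (α + m + 1) * hsq

lemma integral_jacQ_mul_jacQ {α : ℝ} (hα : -1 < α) (N j m : ℕ) :
    ∫ t in (0 : ℝ)..1, jacQ α N j t * jacQ α N m t * (1 - t) ^ α * t ^ N =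
      ∑ k ∈ Finset.range (j + 1), gbinom (α + N + j + k) k * gbinom (N + j) (j - k) *
        (-1 : ℝ) ^ (j - k) * ∫ t in (0 : ℝ)..1, jacQ α N m t * t ^ (k + N) * (1 - t) ^ α := by
  have hexp (t : ℝ) : jacQ α N j t * jacQ α N m t * (1 - t) ^ α * t ^ N =
      ∑ k ∈ Finset.range (j + 1), gbinom (α + N + j + k) k * gbinom (N + j) (j - k) *
        (-1 : ℝ) ^ (j - k) * (jacQ α N m t * t ^ (k + N) * (1 - t) ^ α) := by
    rw [jacQ, Finset.sum_mul, Finset.sum_mul, Finset.sum_mul]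
    exact Finset.sum_congr rfl fun k _ => by ring
  simp_rw [hexp]
  rw [intervalIntegral.integral_finsetSum fun k _ =>
    (intervalIntegrable_mul_one_sub_rpow hα (f := fun t => jacQ α N m t * t ^ (k + N))
      ((continuous_jacQ α N m).mul (continuous_pow _))).const_mul _]
  simp_rw [intervalIntegral.integral_const_mul]

lemma integral_jacQ_mul_jacQ_of_lt {α : ℝ} (hα : -1 < α) (N : ℕ) {j m : ℕ} (hjm : j < m) :
    ∫ t in (0 : ℝ)..1, jacQ α N j t * jacQ α N m t * (1 - t) ^ α * t ^ N = 0 := by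
  rw [integral_jacQ_mul_jacQ hα]
  refine Finset.sum_eq_zero fun k hk => ?_
  rw [integral_jacQ_mul_pow_of_lt hα N (by have := Finset.mem_range.1 hk; lia), mul_zero]

lemma sq_jacCoef {α : ℝ} (hα : -1 < α) (N m : ℕ) (h : 0 < 2 * m + α + N + 1) :
    jacCoef α N m ^ 2 = (2 * m + α + N + 1) * Real.Gamma (m + α + N + 1) * m.factorial /
      (Real.Gamma (m + α + 1) * Real.Gamma (m + N + 1)) := by
  have hN : (0 : ℝ) ≤ N := N.cast_nonneg
  have hm : (0 : ℝ) ≤ m := m.cast_nonneg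
  have h1 := Real.Gamma_pos_of_pos (by linarith : 0 < m + α + N + 1)
  have h2 := Real.Gamma_pos_of_pos (by linarith : 0 < m + α + 1)
  have h3 := Real.Gamma_pos_of_pos (by linarith : (0 : ℝ) < m + N + 1)
  rw [jacCoef, Real.sq_sqrt (by positivity)]

lemma sq_jacCoef_mul_integral_sq_jacQ {α : ℝ} (hα : -1 < α) (N m : ℕ) :
    jacCoef α N m ^ 2 *
      ∫ t in (0 : ℝ)..1, jacQ α N m t * jacQ α N m t * (1 - t) ^ α * t ^ N = 1 := by
  have hN : (0 : ℝ) ≤ N := N.cast_nonneg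
  have hm : (0 : ℝ) ≤ m := m.cast_nonneg
  have h0 : 0 < α + N + 2 * m + 1 := by linarith
  have h1 := Real.Gamma_pos_of_pos (by linarith : 0 < α + N + m + 1)
  have h2 := Real.Gamma_pos_of_pos (by linarith : 0 < α + m + 1)
  have h3 := Real.Gamma_pos_of_pos (by linarith : (0 : ℝ) < N + m + 1)
  have h4 := Real.Gamma_pos_of_pos h0
  have e1 : α + N + m + m - m + 1 = α + N + m + 1 := by ring
  have hlead : gbinom (α + N + m + m) m =
      Real.Gamma (α + N + 2 * m + 1) / (m.factorial * Real.Gamma (α + N + m + 1)) := by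
    rw [gbinom_eq_Gamma_div m (by rw [e1]; linarith), e1]
    ring_nf
  rw [integral_jacQ_mul_jacQ hα, Finset.sum_range_succ, Finset.sum_eq_zero fun k hk => by
    rw [integral_jacQ_mul_pow_of_lt hα N (Finset.mem_range.1 hk), mul_zero],
    integral_jacQ_mul_pow_self hα, sq_jacCoef hα N m (by linarith), hlead,
    show α + N + 2 * m + 2 = α + N + 2 * m + 1 + 1 by ring, Real.Gamma_add_one h0.ne',
    show (2 : ℝ) * m + α + N + 1 = α + N + 2 * m + 1 by ring,
    show (m : ℝ) + α + N + 1 = α + N + m + 1 by ring, add_comm (m : ℝ) α, add_comm (m : ℝ) N]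
  simp only [Nat.sub_self, gbinom, Finset.range_zero, Finset.prod_empty, Nat.factorial_zero]
  field_simp
  simp

lemma abs_jacQ_le {α : ℝ} {B : ℕ} (hB : |α| ≤ B) (N m : ℕ) {t : ℝ} (ht : t ∈ Set.Icc (0 : ℝ) 1) :
    |jacQ α N m t| ≤ (m + 1) * ((N : ℝ) + (B + 3 * m + 1)) ^ m := by
  rw [jacQ]
  refine (Finset.abs_sum_le_sum_abs _ _).trans ?_
  have hterm : ∀ k ∈ Finset.range (m + 1),
      |gbinom (α + N + m + k) k * gbinom (N + m) (m - k) * (-1 : ℝ) ^ (m - k) * t ^ k| ≤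
        ((N : ℝ) + (B + 3 * m + 1)) ^ m := fun k hk => by
    have hkm : k ≤ m := Nat.lt_succ_iff.1 (Finset.mem_range.1 hk)
    have hkm' : (k : ℝ) ≤ m := by exact_mod_cast hkm
    have hmk : ((m - k : ℕ) : ℝ) ≤ m := by exact_mod_cast Nat.sub_le m k
    have hB0 : (0 : ℝ) ≤ B := B.cast_nonneg
    have hα' := abs_le.1 hB
    have htk : |t ^ k| ≤ 1 := by
      rw [abs_of_nonneg (pow_nonneg ht.1 _)]
      exact pow_le_one₀ ht.1 ht.2
    have hx : |α + N + m + k| ≤ B + N + m + k := by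
      rw [abs_le]
      constructor <;> linarith [N.cast_nonneg (α := ℝ), m.cast_nonneg (α := ℝ),
        k.cast_nonneg (α := ℝ)]
    have h1 : |gbinom (α + N + m + k) k| ≤ ((N : ℝ) + (B + 3 * m + 1)) ^ k :=
      (abs_gbinom_le _ _).trans (pow_le_pow_left₀ (by positivity) (by linarith) _)
    have h2 : |gbinom (N + m) (m - k)| ≤ ((N : ℝ) + (B + 3 * m + 1)) ^ (m - k) := by
      refine (abs_gbinom_le _ _).trans (pow_le_pow_left₀ (by positivity) ?_ _)
      rw [abs_of_nonneg (by positivity)]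
      linarith [m.cast_nonneg (α := ℝ)]
    rw [abs_mul, abs_mul, abs_mul, abs_neg_one_pow, mul_one]
    calc _ ≤ ((N : ℝ) + (B + 3 * m + 1)) ^ k * ((N : ℝ) + (B + 3 * m + 1)) ^ (m - k) * 1 := by
          gcongr
      _ = _ := by rw [mul_one, ← pow_add, Nat.add_sub_cancel' hkm]
  refine (Finset.sum_le_sum hterm).trans ?_
  simp

lemma sq_jacCoef_le {α : ℝ} (hα : -1 < α) {B : ℕ} (hB : |α| ≤ B) {N : ℕ} (hN : 2 ≤ N) (m : ℕ) :
    jacCoef α N m ^ 2 ≤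
      m.factorial / Real.Gamma (m + α + 1) * ((N : ℝ) + (B + 3 * m + 1)) ^ (B + 1) := by
  have hN' : (2 : ℝ) ≤ N := by exact_mod_cast hN
  have hm : (0 : ℝ) ≤ m := m.cast_nonneg
  have hB0 : (0 : ℝ) ≤ B := B.cast_nonneg
  have hα' := abs_le.1 hB
  have h2 := Real.Gamma_pos_of_pos (by linarith : 0 < m + α + 1)
  have h3 := Real.Gamma_pos_of_pos (by linarith : (0 : ℝ) < m + N + 1)
  have hprod : ∏ i ∈ Finset.range B, ((m : ℝ) + N + 1 + i) ≤
      ((N : ℝ) + (B + 3 * m + 1)) ^ B := by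
    refine (Finset.prod_le_prod (g := fun _ => (N : ℝ) + (B + 3 * m + 1))
      (fun _ _ => by positivity) fun i hi => ?_).trans (by simp)
    have : (i : ℝ) ≤ B := by exact_mod_cast (Finset.mem_range.1 hi).le
    linarith
  have hΓ : Real.Gamma (m + α + N + 1) ≤
      ((N : ℝ) + (B + 3 * m + 1)) ^ B * Real.Gamma (m + N + 1) := by
    calc Real.Gamma (m + α + N + 1) ≤ Real.Gamma (m + N + 1 + B) :=
          Real.Gamma_strictMonoOn_Ici.monotoneOn (Set.mem_Ici.2 (by linarith))
            (Set.mem_Ici.2 (by linarith)) (by linarith)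
      _ = (∏ i ∈ Finset.range B, ((m : ℝ) + N + 1 + i)) * Real.Gamma (m + N + 1) :=
          Gamma_add_natCast_eq_prod (by linarith) B
      _ ≤ _ := by gcongr
  rw [sq_jacCoef hα N m (by linarith), div_le_iff₀ (by positivity)]
  calc (2 * m + α + N + 1) * Real.Gamma (m + α + N + 1) * m.factorial
      ≤ ((N : ℝ) + (B + 3 * m + 1)) *
        (((N : ℝ) + (B + 3 * m + 1)) ^ B * Real.Gamma (m + N + 1)) * m.factorial := by
        have := Real.Gamma_pos_of_pos (by linarith : 0 < m + α + N + 1)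
        exact mul_le_mul_of_nonneg_right
          (mul_le_mul (by linarith) hΓ this.le (by positivity)) (Nat.cast_nonneg _)
    _ = _ := by field_simp; ring

/-- On `[0,1]` the squared normalized Jacobi polynomials grow at most polynomially in `β = N`. -/
lemma exists_sq_jacCoef_mul_jacQ_le {α : ℝ} (hα : -1 < α) (m : ℕ) :
    ∃ (K : ℝ) (A D : ℕ), ∀ N : ℕ, 2 ≤ N → ∀ t ∈ Set.Icc (0 : ℝ) 1,
      (jacCoef α N m * jacQ α N m t) ^ 2 ≤ K * ((N + A : ℕ) : ℝ) ^ D := by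
  obtain ⟨B, hB⟩ := exists_nat_ge |α|
  refine ⟨m.factorial / Real.Gamma (m + α + 1) * (m + 1) ^ 2, B + 3 * m + 1, B + 1 + 2 * m,
    fun N hN t ht => ?_⟩
  have h2 := Real.Gamma_pos_of_pos (by linarith [m.cast_nonneg (α := ℝ)] : 0 < m + α + 1)
  rw [mul_pow, ← sq_abs (jacQ α N m t)]
  calc _ ≤ (m.factorial / Real.Gamma (m + α + 1) * ((N : ℝ) + (B + 3 * m + 1)) ^ (B + 1)) *
        ((m + 1) * ((N : ℝ) + (B + 3 * m + 1)) ^ m) ^ 2 := by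
        gcongr
        · exact sq_jacCoef_le hα hB hN m
        · exact abs_jacQ_le hB N m ht
    _ = _ := by push_cast; ring

lemma tendsto_add_pow_mul_pow (A D : ℕ) {ρ : ℝ} (h0 : 0 < ρ) (h1 : ρ < 1) :
    Tendsto (fun N : ℕ => ((N + A : ℕ) : ℝ) ^ D * ρ ^ N) atTop (nhds 0) := by
  have h := ((tendsto_pow_const_mul_const_pow_of_lt_one D h0.le h1).comp
    (tendsto_add_atTop_nat A)).mul_const (ρ ^ A)⁻¹
  rw [zero_mul] at h
  refine h.congr fun N => ?_
  have := (pow_pos h0 A).ne'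
  simp only [Function.comp_apply, pow_add ρ]
  field_simp

lemma IntervalIntegrable.bdd_mul_of_measurable {𝕜 : Type*} [RCLike 𝕜] {f g : ℝ → 𝕜} {C : ℝ}
    (hg : IntervalIntegrable g volume 0 1) (hf : Measurable f)
    (hC : ∀ t ∈ Set.Ioo (0 : ℝ) 1, ‖f t‖ ≤ C) :
    IntervalIntegrable (fun t => f t * g t) volume 0 1 := by
  rw [intervalIntegrable_iff_integrableOn_Ioo_of_le zero_le_one] at hg ⊢
  exact Integrable.bdd_mul hg hf.aestronglyMeasurable
    ((ae_restrict_iff' measurableSet_Ioo).2 (Eventually.of_forall hC))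

lemma intervalIntegrable_sq_jacobi {α : ℝ} (hα : -1 < α) (N m : ℕ) :
    IntervalIntegrable (fun t : ℝ => (jacCoef α N m * jacQ α N m t) ^ 2 * t ^ N * (1 - t) ^ α)
      volume 0 1 :=
  intervalIntegrable_mul_one_sub_rpow hα
    (((continuous_const.mul (continuous_jacQ α N m)).pow 2).mul (continuous_pow N))

lemma integral_sq_jacobi {α : ℝ} (hα : -1 < α) (N m : ℕ) :
    ∫ t in (0 : ℝ)..1, (jacCoef α N m * jacQ α N m t) ^ 2 * t ^ N * (1 - t) ^ α = 1 := by
  refine Eq.trans ?_ (sq_jacCoef_mul_integral_sq_jacQ hα N m)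
  rw [← intervalIntegral.integral_const_mul]
  exact intervalIntegral.integral_congr fun t _ => by ring

/-- The probability densities `κ² Q_m² t^N (1-t)^α` concentrate at `1` as `N → ∞`. -/
lemma tendsto_integral_mul_sq_jacobi {α : ℝ} (hα : -1 < α) (m : ℕ) {b : ℝ → ℝ} {C : ℝ}
    (hb : Measurable b) (hb0 : ∀ t, 0 ≤ b t) (hbC : ∀ t ∈ Set.Ioo (0 : ℝ) 1, b t ≤ C)
    (hlim : Tendsto b (nhdsWithin 1 (Set.Iio 1)) (nhds 0)) :
    Tendsto (fun N : ℕ => ∫ t in (0 : ℝ)..1,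
      b t * ((jacCoef α N m * jacQ α N m t) ^ 2 * t ^ N * (1 - t) ^ α)) atTop (nhds 0) := by
  obtain ⟨K, A, D, hK⟩ := exists_sq_jacCoef_mul_jacQ_le hα m
  have hC0 : 0 ≤ C := (hb0 2⁻¹).trans (hbC _ (by norm_num))
  have hnonneg : ∀ N : ℕ, ∀ t ∈ Set.Icc (0 : ℝ) 1,
      0 ≤ (jacCoef α N m * jacQ α N m t) ^ 2 * t ^ N * (1 - t) ^ α := fun N t ht =>
    mul_nonneg (mul_nonneg (sq_nonneg _) (pow_nonneg ht.1 _))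
      (Real.rpow_nonneg (sub_nonneg.2 ht.2) _)
  have hbnorm : ∀ t ∈ Set.Ioo (0 : ℝ) 1, ‖b t‖ ≤ C := fun t ht => by
    rw [Real.norm_of_nonneg (hb0 t)]; exact hbC t ht
  refine tendsto_order.2 ⟨fun c hc => Eventually.of_forall fun N => hc.trans_le ?_, fun ε hε => ?_⟩
  · exact intervalIntegral.integral_nonneg zero_le_one fun t ht =>
      mul_nonneg (hb0 t) (hnonneg N t ht)
  obtain ⟨l, hl1, hl⟩ := mem_nhdsLT_iff_exists_Ioo_subset.1
    (hlim.eventually (gt_mem_nhds (half_pos hε)))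
  set ρ := max l 2⁻¹
  have hρ0 : 0 < ρ := lt_max_of_lt_right (by norm_num)
  have hρ1 : ρ < 1 := max_lt hl1 (by norm_num)
  have hsmall := ((tendsto_add_pow_mul_pow A D hρ0 hρ1).const_mul
    (C * K * ∫ t in (0 : ℝ)..1, (1 - t) ^ α)).eventually
    (gt_mem_nhds (by rw [mul_zero]; exact half_pos hε))
  filter_upwards [hsmall, eventually_ge_atTop 2] with N hN hN2
  have hsq := intervalIntegrable_sq_jacobi hα N m
  have hw := intervalIntegrable_one_sub_rpow hα
  calc _ ≤ ∫ t in (0 : ℝ)..1,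
        ((ε / 2) * ((jacCoef α N m * jacQ α N m t) ^ 2 * t ^ N * (1 - t) ^ α) +
        C * (K * ((N + A : ℕ) : ℝ) ^ D * ρ ^ N) * (1 - t) ^ α) := by
        refine intervalIntegral.integral_mono_on_of_le_Ioo zero_le_one
          (hsq.bdd_mul_of_measurable hb hbnorm)
          ((hsq.const_mul _).add (hw.const_mul _)) fun t ht => ?_
        have htI := Set.Ioo_subset_Icc_self ht
        have hpos := hnonneg N t htI
        have hwt : 0 ≤ (1 - t) ^ α := Real.rpow_nonneg (sub_nonneg.2 ht.2.le) _
        have hKN := hK N hN2 t htI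
        have hK0 := (sq_nonneg _).trans hKN
        rcases le_or_gt t ρ with htρ | htρ
        · have h1 : b t * ((jacCoef α N m * jacQ α N m t) ^ 2 * t ^ N * (1 - t) ^ α) ≤
              C * (K * ((N + A : ℕ) : ℝ) ^ D * ρ ^ N * (1 - t) ^ α) := by
            have := ht.1.le
            gcongr
            exact hbC t ht
          have h2 := mul_nonneg (half_pos hε).le hpos
          linarith
        · have h1 : b t < ε / 2 := hl ⟨(le_max_left _ _).trans_lt htρ, ht.2⟩
          have h2 := mul_le_mul_of_nonneg_right h1.le hpos
          have h3 : 0 ≤ C * (K * ((N + A : ℕ) : ℝ) ^ D * ρ ^ N) * (1 - t) ^ α := by positivity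
          linarith
    _ = ε / 2 + (C * K * ∫ t in (0 : ℝ)..1, (1 - t) ^ α) * (((N + A : ℕ) : ℝ) ^ D * ρ ^ N) := by
        rw [intervalIntegral.integral_add (hsq.const_mul _) (hw.const_mul _),
          intervalIntegral.integral_const_mul, intervalIntegral.integral_const_mul,
          integral_sq_jacobi hα]
        ring
    _ < ε := by linarith

lemma jacCoef_mul_integral_jacQ_mul_jacQ {α : ℝ} (hα : -1 < α) (N j k : ℕ) :
    jacCoef α N j * jacCoef α N k *
      ∫ t in (0 : ℝ)..1, jacQ α N j t * jacQ α N k t * (1 - t) ^ α * t ^ N =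
        if j = k then 1 else 0 := by
  rcases lt_trichotomy j k with h | rfl | h
  · rw [integral_jacQ_mul_jacQ_of_lt hα N h, mul_zero, if_neg h.ne]
  · rw [← pow_two, sq_jacCoef_mul_integral_sq_jacQ hα, if_pos rfl]
  · simp_rw [mul_comm (jacQ α N j _)]
    rw [integral_jacQ_mul_jacQ_of_lt hα N h, mul_zero, if_neg h.ne']

/-- The deviation of `γ(a)_{N,j,k}` from `ω δ_{j,k}` is controlled by the mean oscillations of `a`
around `ω` against the two squared Jacobi densities. -/
lemma norm_gammaEnt_sub_le {α : ℝ} (hα : -1 < α) {a : ℝ → ℂ} (ha : Measurable a) {C : ℝ}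
    (hC : ∀ r ∈ Set.Ico (0 : ℝ) 1, ‖a r‖ ≤ C) (ω : ℂ) (N j k : ℕ) :
    ‖gammaEnt α a N j k - (if j = k then ω else 0)‖ ≤
      2⁻¹ * ((∫ t in (0 : ℝ)..1, ‖a √t - ω‖ *
          ((jacCoef α N j * jacQ α N j t) ^ 2 * t ^ N * (1 - t) ^ α)) +
        ∫ t in (0 : ℝ)..1, ‖a √t - ω‖ *
          ((jacCoef α N k * jacQ α N k t) ^ 2 * t ^ N * (1 - t) ^ α)) := by
  have hsqrt : ∀ t ∈ Set.Ioo (0 : ℝ) 1, ‖a √t‖ ≤ C := fun t ht =>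
    hC _ ⟨Real.sqrt_nonneg t, by rw [Real.sqrt_lt' one_pos]; simpa using ht.2⟩
  have hasq : Measurable fun t => a √t := ha.comp Real.continuous_sqrt.measurable
  have hosc : ∀ t ∈ Set.Ioo (0 : ℝ) 1, ‖‖a √t - ω‖‖ ≤ C + ‖ω‖ := fun t ht => by
    rw [norm_norm]
    exact (norm_sub_le _ _).trans (by gcongr; exact hsqrt t ht)
  have hg : IntervalIntegrable (fun t : ℝ =>
      ((jacQ α N j t * jacQ α N k t * (1 - t) ^ α * t ^ N : ℝ) : ℂ)) volume 0 1 := by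
    have h := intervalIntegrable_mul_one_sub_rpow hα
      (f := fun t => jacQ α N j t * jacQ α N k t * t ^ N)
      (((continuous_jacQ α N j).mul (continuous_jacQ α N k)).mul (continuous_pow N))
    refine IntervalIntegrable.congr (fun t _ => ?_) ⟨h.1.ofReal, h.2.ofReal⟩
    exact congrArg Complex.ofReal (mul_right_comm _ _ _)
  have hω : (if j = k then ω else 0) = ((jacCoef α N j * jacCoef α N k : ℝ) : ℂ) *
      ∫ t in (0 : ℝ)..1, ω * ((jacQ α N j t * jacQ α N k t * (1 - t) ^ α * t ^ N : ℝ) : ℂ) := by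
    rw [intervalIntegral.integral_const_mul, intervalIntegral.integral_ofReal, mul_left_comm,
      ← Complex.ofReal_mul, jacCoef_mul_integral_jacQ_mul_jacQ hα]
    split_ifs <;> simp
  rw [gammaEnt, Int.natAbs_natCast, hω, ← mul_sub, ← intervalIntegral.integral_sub
    (hg.bdd_mul_of_measurable hasq hsqrt) (hg.const_mul ω),
    ← intervalIntegral.integral_const_mul, ← intervalIntegral.integral_add
    ((intervalIntegrable_sq_jacobi hα N j).bdd_mul_of_measurable (hasq.sub_const ω).norm hosc)
    ((intervalIntegrable_sq_jacobi hα N k).bdd_mul_of_measurable (hasq.sub_const ω).norm hosc),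
    ← intervalIntegral.integral_const_mul]
  refine intervalIntegral.norm_integral_le_of_norm_le zero_le_one
    (Eventually.of_forall fun t ht => ?_)
    ((((intervalIntegrable_sq_jacobi hα N j).bdd_mul_of_measurable
      (hasq.sub_const ω).norm hosc).add ((intervalIntegrable_sq_jacobi hα N k).bdd_mul_of_measurable
      (hasq.sub_const ω).norm hosc)).const_mul _)
  have hw : 0 ≤ t ^ N * (1 - t) ^ α :=
    mul_nonneg (pow_nonneg ht.1.le _) (Real.rpow_nonneg (sub_nonneg.2 ht.2) _)
  rw [← sub_mul, mul_left_comm, ← Complex.ofReal_mul, norm_mul, Complex.norm_real, Real.norm_eq_abs]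
  have hfac : jacCoef α N j * jacCoef α N k *
      (jacQ α N j t * jacQ α N k t * (1 - t) ^ α * t ^ N) =
      ((jacCoef α N j * jacQ α N j t) * (jacCoef α N k * jacQ α N k t)) *
        (t ^ N * (1 - t) ^ α) := by ring
  rw [hfac, abs_mul, abs_of_nonneg hw, abs_mul]
  have hamgm := two_mul_le_add_sq |jacCoef α N j * jacQ α N j t| |jacCoef α N k * jacQ α N k t|
  rw [sq_abs, sq_abs] at hamgm
  calc _ ≤ ‖a √t - ω‖ * (2⁻¹ * ((jacCoef α N j * jacQ α N j t) ^ 2 +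
        (jacCoef α N k * jacQ α N k t) ^ 2) * (t ^ N * (1 - t) ^ α)) := by
        refine mul_le_mul_of_nonneg_left (mul_le_mul_of_nonneg_right ?_ hw) (norm_nonneg _)
        linarith
    _ = _ := by ring

/-- if the bounded measurable symbol `a` has limit `ω` at `1⁻`, then
`γ(a)_ξ → ω I_n` entrywise as `ξ → +∞`. -/
theorem statement6 (n : ℕ) (hn : 1 ≤ n) (α : ℝ) (hα : -1 < α) (a : ℝ → ℂ)
    (ha_meas : Measurable a) (ha_bdd : ∃ C : ℝ, ∀ r ∈ Set.Ico (0:ℝ) 1, ‖a r‖ ≤ C)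
    (ω : ℂ) (hω : Tendsto a (nhdsWithin 1 (Set.Ico (0:ℝ) 1)) (nhds ω)) :
    ∀ j k : Fin n, Tendsto (fun ξ : ℕ => gammaEnt α a (ξ : ℤ) (j : ℕ) (k : ℕ))
      atTop (nhds (if j = k then ω else 0)) := by
  intro j k
  obtain ⟨C, hC⟩ := ha_bdd
  have hsqrt : ∀ t : ℝ, t < 1 → √t ∈ Set.Ico (0 : ℝ) 1 := fun t ht =>
    ⟨Real.sqrt_nonneg t, by rw [Real.sqrt_lt' one_pos]; simpa using ht⟩
  have hlim : Tendsto (fun t => ‖a √t - ω‖) (nhdsWithin 1 (Set.Iio 1)) (nhds 0) := by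
    rw [← tendsto_iff_norm_sub_tendsto_zero]
    refine hω.comp (tendsto_nhdsWithin_iff.2 ⟨?_, ?_⟩)
    · have h := Real.continuous_sqrt.tendsto 1
      rw [Real.sqrt_one] at h
      exact h.mono_left nhdsWithin_le_nhds
    · filter_upwards [self_mem_nhdsWithin] with t ht using hsqrt t ht
  have hzero (m : ℕ) := tendsto_integral_mul_sq_jacobi hα m (C := C + ‖ω‖)
    ((ha_meas.comp Real.continuous_sqrt.measurable).sub_const ω).norm (fun t => norm_nonneg _)
    (fun t ht => (norm_sub_le _ _).trans (by gcongr; exact hC _ (hsqrt t ht.2))) hlim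
  rw [tendsto_iff_norm_sub_tendsto_zero]
  refine squeeze_zero (fun _ => norm_nonneg _) (fun N => ?_)
    (by simpa using ((hzero j).add (hzero k)).const_mul 2⁻¹)
  simpa only [Fin.ext_iff] using norm_gammaEnt_sub_le hα ha_meas hC ω N j k
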